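/- Let I be a square-free monomial ideal of R = K[x_1,…,x_r]. Then for all n ≥ 1, reg(I^{(n)}) ≤ δ(I)·(n − 1) + dim(R/I) + 1. -/

import Mathlib

open MvPolynomial Finset Filter

noncomputable section

/-- A family of potential faces (subsets of the vertex set `ι`). -/
abbrev FaceSet (ι : Type*) := Set (Finset ι)

/-- A face set is a simplicial complex if it is closed under taking subsets. -/
def IsSimplicialComplex {ι : Type*} (Δ : FaceSet ι) : Prop :=
  ∀ σ ∈ Δ, ∀ τ : Finset ι, τ ⊆ σ → τ ∈ Δ

/-- The facets (maximal faces) of a face set. -/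
def facets {ι : Type*} (Δ : FaceSet ι) : FaceSet ι :=
  {σ | σ ∈ Δ ∧ ∀ τ ∈ Δ, σ ⊆ τ → σ = τ}

/-- The Stanley–Reisner ideal of a simplicial complex: it is generated by the
square-free monomials corresponding to non-faces. -/
def srIdeal (K : Type*) [Field K] {ι : Type*} (Δ : FaceSet ι) :
    Ideal (MvPolynomial ι K) :=
  Ideal.span {p | ∃ τ : Finset ι, τ ∉ Δ ∧ p = ∏ i ∈ τ, X i}

/-- The `n`-th symbolic power `I^{(n)} = ⋂_{p ∈ Min(I)} (Iⁿ R_p ∩ R)`. -/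
def symbolicPower {R : Type*} [CommRing R] (I : Ideal R) (n : ℕ) : Ideal R :=
  ⨅ (p : Ideal R) (hp : p ∈ I.minimalPrimes),
    letI : p.IsPrime := hp.1.1
    (Ideal.map (algebraMap R (Localization.AtPrime p)) (I ^ n)).comap
      (algebraMap R (Localization.AtPrime p))

/-- The simplicial boundary operator on the space of chains (finitely supported
`K`-valued functions on finite subsets of `ι`), using the orientation coming
from the linear order of `ι`; a set of cardinality `d` is viewed as a
`(d-1)`-dimensional simplex, the empty set accounting for the augmentation. -/
def bdry (K : Type*) [Field K] {ι : Type*} [LinearOrder ι] :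
    (Finset ι →₀ K) →ₗ[K] (Finset ι →₀ K) :=
  Finsupp.lsum K fun σ => LinearMap.toSpanSingleton K _
    (∑ v ∈ σ, ((-1 : K) ^ (σ.filter fun w => w < v).card) • Finsupp.single (σ.erase v) (1 : K))

/-- The subspace of chains supported on the faces of `Δ` of cardinality `d`. -/
def cardFaces (K : Type*) [Field K] {ι : Type*} (Δ : FaceSet ι) (d : ℕ) :
    Submodule K (Finset ι →₀ K) :=
  Submodule.span K {f | ∃ σ ∈ Δ, σ.card = d ∧ f = Finsupp.single σ (1 : K)}

/-- `H̃ⱼ(Δ; K) ≠ 0`: there is a cycle of cardinality-degree `j + 1` which is not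
a boundary of a chain of `Δ`. -/
def HasNontrivialReducedHomology (K : Type*) [Field K] {ι : Type*} [LinearOrder ι]
    (Δ : FaceSet ι) (j : ℤ) : Prop :=
  ∃ d : ℕ, (d : ℤ) = j + 1 ∧
    ∃ z ∈ cardFaces K Δ d, bdry K z = 0 ∧ z ∉ ⇑(bdry K) '' ↑(cardFaces K Δ (d + 1))

/-- `G_α = {i : α_i < 0}`. -/
def negSupport {ι : Type*} [Fintype ι] (α : ι → ℤ) : Finset ι :=
  Finset.univ.filter fun i => α i < 0

/-- The degree complex `Δ_α(I) = {F ⊆ [r] \ G_α : x^α ∉ I·R_F}` of Takayama, where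
`x^α ∈ I·R_F` is expressed by saturation: `x^{α⁺}·(∏_{i ∈ F ∪ G_α} x_i)^m ∈ I` for some `m`. -/
def degreeComplex (K : Type*) [Field K] {ι : Type*} [Fintype ι] [LinearOrder ι]
    (I : Ideal (MvPolynomial ι K)) (α : ι → ℤ) : FaceSet ι :=
  {F | (∀ i ∈ F, 0 ≤ α i) ∧
    ¬∃ m : ℕ,
      monomial (Finsupp.equivFunOnFinite.symm fun i => (α i).toNat) (1 : K) *
        (∏ i ∈ F ∪ negSupport α, X i) ^ m ∈ I}

/-- Nonvanishing of the graded piece `H_𝔪^i(R/I)_α` of local cohomology of a monomial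
quotient, expressed via Takayama's formula
`dim_K H_𝔪^i(R/I)_α = dim_K H̃_{i-|G_α|-1}(Δ_α(I); K)`. -/
def lcNonzero (K : Type*) [Field K] {ι : Type*} [Fintype ι] [LinearOrder ι]
    (I : Ideal (MvPolynomial ι K)) (i : ℕ) (α : ι → ℤ) : Prop :=
  HasNontrivialReducedHomology K (degreeComplex K I α) ((i : ℤ) - (negSupport α).card - 1)

/-- The `a_i`-invariant `a_i(R/I) = max{t : H_𝔪^i(R/I)_t ≠ 0}` of a monomial quotient
(`H_𝔪^i(R/I)_t = ⊕_{|α| = t} H_𝔪^i(R/I)_α`). -/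
def aInv (K : Type*) [Field K] {ι : Type*} [Fintype ι] [LinearOrder ι]
    (I : Ideal (MvPolynomial ι K)) (i : ℕ) : ℤ :=
  sSup {z : ℤ | ∃ α : ι → ℤ, lcNonzero K I i α ∧ z = ∑ j, α j}

/-- The Castelnuovo–Mumford regularity `reg(R/I) = max_i (a_i(R/I) + i)` of a
monomial quotient. -/
def regQuot (K : Type*) [Field K] {ι : Type*} [Fintype ι] [LinearOrder ι]
    (I : Ideal (MvPolynomial ι K)) : ℤ :=
  sSup {z : ℤ | ∃ (i : ℕ) (α : ι → ℤ), lcNonzero K I i α ∧ z = (∑ j, α j) + i}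

/-- The Castelnuovo–Mumford regularity of a (monomial) ideal: `reg(I) = reg(R/I) + 1`. -/
def reg (K : Type*) [Field K] {ι : Type*} [Fintype ι] [LinearOrder ι]
    (I : Ideal (MvPolynomial ι K)) : ℤ :=
  regQuot K I + 1

/-- The depth `min{i : H_𝔪^i(R/I) ≠ 0}` of a monomial quotient. -/
def depthQuot (K : Type*) [Field K] {ι : Type*} [Fintype ι] [LinearOrder ι]
    (I : Ideal (MvPolynomial ι K)) : ℕ :=
  sInf {i : ℕ | ∃ α : ι → ℤ, lcNonzero K I i α}

/-- The projective dimension `pd(R/I) = r - depth(R/I)` (Auslander–Buchsbaum). -/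
def pdQuot (K : Type*) [Field K] {ι : Type*} [Fintype ι] [LinearOrder ι]
    (I : Ideal (MvPolynomial ι K)) : ℤ :=
  (Fintype.card ι : ℤ) - depthQuot K I

end
section Cone

variable (K : Type*) [Field K] {ι : Type*} [LinearOrder ι]

/-- The incidence sign of `v` with respect to `σ`. -/
noncomputable def coneSign (σ : Finset ι) (v : ι) : K :=
  (-1) ^ (σ.filter fun w => w < v).card

/-- The operator on chains adjoining a vertex `v`, a contracting homotopy for cones. -/
noncomputable def coneOp (v : ι) : (Finset ι →₀ K) →ₗ[K] (Finset ι →₀ K) :=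
  Finsupp.lsum K fun σ => LinearMap.toSpanSingleton K _
    (if v ∈ σ then 0 else coneSign K σ v • Finsupp.single (insert v σ) (1 : K))

lemma coneSign_mul_self (σ : Finset ι) (v : ι) :
    coneSign K σ v * coneSign K σ v = 1 := by
  rw [coneSign, ← mul_pow]; simp

lemma coneSign_insert_self (σ : Finset ι) (v : ι) :
    coneSign K (insert v σ) v = coneSign K σ v := by
  simp [coneSign, Finset.filter_insert]

lemma coneSign_swap {σ : Finset ι} {v w : ι} (hv : v ∉ σ) (hw : w ∈ σ) :
    coneSign K σ v * coneSign K (insert v σ) w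
      + coneSign K σ w * coneSign K (σ.erase w) v = 0 := by
  have hvw : v ≠ w := fun h => hv (h ▸ hw)
  rcases lt_or_gt_of_ne hvw with h | h
  · have h1 : ¬ w < v := not_lt.mpr h.le
    have h2 : (σ.erase w).filter (fun u => u < v) = σ.filter fun u => u < v := by
      rw [Finset.filter_erase, Finset.erase_eq_of_notMem]
      simp [h1]
    have h3 : ((insert v σ).filter fun u => u < w).card
        = (σ.filter fun u => u < w).card + 1 := by
      rw [Finset.filter_insert, if_pos h, Finset.card_insert_of_notMem]
      simp [hv]
    simp only [coneSign, h2, h3]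
    ring
  · have h1 : ¬ v < w := not_lt.mpr h.le
    have h2 : (σ.filter fun u => u < v).card
        = ((σ.erase w).filter fun u => u < v).card + 1 := by
      rw [Finset.filter_erase, Finset.card_erase_add_one]
      simp [hw, h]
    have h3 : (insert v σ).filter (fun u => u < w) = σ.filter fun u => u < w := by
      rw [Finset.filter_insert, if_neg h1]
    simp only [coneSign, h2, h3]
    ring

lemma bdry_single (σ : Finset ι) :
    bdry K (Finsupp.single σ 1)
      = ∑ v ∈ σ, coneSign K σ v • Finsupp.single (σ.erase v) (1 : K) := by
  simp [bdry, coneSign]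

lemma coneOp_single (v : ι) (σ : Finset ι) :
    coneOp K v (Finsupp.single σ 1)
      = if v ∈ σ then 0 else coneSign K σ v • Finsupp.single (insert v σ) (1 : K) := by
  simp [coneOp]

lemma bdry_coneOp_add (v : ι) (c : Finset ι →₀ K) :
    bdry K (coneOp K v c) + coneOp K v (bdry K c) = c := by
  suffices h : (bdry K) ∘ₗ (coneOp K v) + (coneOp K v) ∘ₗ (bdry K) = LinearMap.id from
    LinearMap.congr_fun h c
  refine Finsupp.lhom_ext' fun σ => LinearMap.ext_ring ?_
  simp only [LinearMap.comp_apply, LinearMap.add_apply, Finsupp.lsingle_apply, LinearMap.id_apply,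
    bdry_single, coneOp_single, map_sum, map_smul]
  by_cases hv : v ∈ σ
  · rw [if_pos hv, map_zero, zero_add, Finset.sum_eq_single v]
    · have := coneSign_insert_self K (σ.erase v) v
      rw [Finset.insert_erase hv] at this
      rw [if_neg (Finset.notMem_erase v σ), smul_smul, Finset.insert_erase hv, ← this,
        coneSign_mul_self, one_smul]
    · intro w hw hwv
      rw [if_pos (Finset.mem_erase.mpr ⟨hwv.symm, hv⟩), smul_zero]
    · exact fun h => absurd hv h
  · rw [if_neg hv, map_smul, bdry_single, Finset.sum_insert hv, smul_add, smul_smul,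
      coneSign_insert_self, coneSign_mul_self, one_smul, Finset.erase_insert hv, add_assoc,
      Finset.smul_sum, ← Finset.sum_add_distrib]
    rw [Finset.sum_eq_zero, add_zero]
    intro w hw
    have hvw : v ≠ w := fun h => hv (h ▸ hw)
    rw [if_neg (fun h => hv (Finset.mem_of_mem_erase h)), smul_smul, smul_smul,
      Finset.erase_insert_of_ne hvw, ← add_smul, coneSign_swap K hv hw, zero_smul]

lemma coneOp_mem_cardFaces {Δ : FaceSet ι} {v : ι}
    (hΔ : ∀ σ ∈ Δ, insert v σ ∈ Δ) {d : ℕ} {c : Finset ι →₀ K} (hc : c ∈ cardFaces K Δ d) :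
    coneOp K v c ∈ cardFaces K Δ (d + 1) := by
  refine Submodule.span_induction (p := fun c _ => coneOp K v c ∈ cardFaces K Δ (d + 1))
    ?_ ?_ ?_ ?_ hc
  · rintro _ ⟨σ, hσ, hd, rfl⟩
    rw [coneOp_single]
    split_ifs with hv
    · exact zero_mem _
    · exact Submodule.smul_mem _ _ (Submodule.subset_span
        ⟨_, hΔ σ hσ, by rw [Finset.card_insert_of_notMem hv, hd], rfl⟩)
  · simp
  · intro x y _ _ hx hy
    rw [map_add]
    exact add_mem hx hy
  · intro a x _ hx
    rw [map_smul]
    exact Submodule.smul_mem _ _ hx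

/-- A cone has no reduced homology. -/
lemma not_hasNontrivialReducedHomology_of_cone {Δ : FaceSet ι} {v : ι}
    (hΔ : ∀ σ ∈ Δ, insert v σ ∈ Δ) (j : ℤ) : ¬ HasNontrivialReducedHomology K Δ j := by
  rintro ⟨d, -, z, hz, hz0, hzb⟩
  refine hzb ⟨coneOp K v z, coneOp_mem_cardFaces K hΔ hz, ?_⟩
  simpa [hz0] using bdry_coneOp_add K v z

lemma exists_face_of_hasNontrivialReducedHomology {Δ : FaceSet ι} {j : ℤ}
    (h : HasNontrivialReducedHomology K Δ j) : ∃ σ ∈ Δ, (σ.card : ℤ) = j + 1 := by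
  obtain ⟨d, hd, z, hz, -, hzb⟩ := h
  by_contra! hne
  have hbot : cardFaces K Δ d = ⊥ := by
    rw [cardFaces, Submodule.span_eq_bot]
    rintro _ ⟨σ, hσ, rfl, -⟩
    exact absurd hd (hne σ hσ)
  rw [hbot, Submodule.mem_bot] at hz
  exact hzb ⟨0, zero_mem _, by simp [hz]⟩

/-- The complex `{∅}` has homology in degree `-1`. -/
lemma hasNontrivialReducedHomology_singleton_empty :
    HasNontrivialReducedHomology K ({∅} : FaceSet ι) (-1) := by
  refine ⟨0, by simp, Finsupp.single ∅ 1, Submodule.subset_span ⟨∅, rfl, rfl, rfl⟩, ?_, ?_⟩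
  · simp [bdry_single]
  · rintro ⟨c, hc, hcz⟩
    have hbot : cardFaces K ({∅} : FaceSet ι) (0 + 1) = ⊥ := by
      rw [cardFaces, Submodule.span_eq_bot]
      rintro _ ⟨σ, rfl, hσ, -⟩
      simp at hσ
    rw [hbot, SetLike.mem_coe, Submodule.mem_bot] at hc
    rw [hc, map_zero, eq_comm, Finsupp.single_eq_zero] at hcz
    exact one_ne_zero hcz

end Cone

section FacePrime

variable (K : Type*) [Field K] {ι : Type*}

/-- The prime ideal generated by the variables outside `H`. -/
noncomputable def facePrime (H : Finset ι) : Ideal (MvPolynomial ι K) :=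
  Ideal.span (X '' {i | i ∉ H})

lemma facePrime_eq_ker (H : Finset ι) :
    facePrime K H = RingHom.ker (killCompl (R := K) (Subtype.val_injective (p := (· ∈ H)))) := by
  apply le_antisymm
  · rw [facePrime, Ideal.span_le]
    rintro _ ⟨i, hi, rfl⟩
    simpa [killCompl, RingHom.mem_ker] using hi
  · intro f hf
    have key : ∀ f : MvPolynomial ι K, f - rename Subtype.val
        (killCompl (R := K) (Subtype.val_injective (p := (· ∈ H))) f) ∈ facePrime K H := by
      intro f
      induction f using MvPolynomial.induction_on with
      | C a => simp
      | add p q hp hq =>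
        rw [map_add, map_add, add_sub_add_comm]
        exact add_mem hp hq
      | mul_X p i hp =>
        by_cases hi : i ∈ H
        · have : rename Subtype.val (killCompl (R := K)
              (Subtype.val_injective (p := (· ∈ H))) (X i)) = X i := by
            have hX : (X i : MvPolynomial ι K) = rename Subtype.val (X (⟨i, hi⟩ : H)) := by simp
            rw [hX, killCompl_rename_app]
          rw [map_mul, map_mul, this, ← sub_mul]
          exact Ideal.mul_mem_right _ _ hp
        · have : killCompl (R := K) (Subtype.val_injective (p := (· ∈ H))) (X i) = 0 := by
            simp [killCompl, hi]
          rw [map_mul, this, mul_zero, map_zero, sub_zero]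
          exact Ideal.mul_mem_left _ _ (Ideal.subset_span ⟨i, hi, rfl⟩)
    have := key f
    rwa [RingHom.mem_ker.mp hf, map_zero, sub_zero] at this

lemma facePrime_isPrime (H : Finset ι) : (facePrime K H).IsPrime := by
  rw [facePrime_eq_ker]
  exact RingHom.ker_isPrime _

lemma X_mem_facePrime_iff {H : Finset ι} {i : ι} :
    (X i : MvPolynomial ι K) ∈ facePrime K H ↔ i ∉ H := by
  rw [facePrime_eq_ker, RingHom.mem_ker]
  simp [killCompl]

lemma card_le_ringKrullDim_quotient {H : Finset ι} {I : Ideal (MvPolynomial ι K)}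
    (hI : I ≤ facePrime K H) :
    (H.card : WithBot ℕ∞) ≤ ringKrullDim (MvPolynomial ι K ⧸ I) := by
  rw [facePrime_eq_ker] at hI
  have h1 := ringKrullDim_add_natCard_le_ringKrullDim_mvPolynomial (R := K) H
  rw [ringKrullDim_eq_zero_of_field, zero_add, Nat.card_eq_fintype_card, Fintype.card_coe] at h1
  refine h1.trans (ringKrullDim_le_of_surjective (Ideal.Quotient.lift I
    (killCompl (R := K) (Subtype.val_injective (p := (· ∈ H)))).toRingHom fun a ha => hI ha) ?_)
  refine Ideal.Quotient.lift_surjective_of_surjective _ _ fun p => ⟨rename Subtype.val p, ?_⟩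
  exact killCompl_rename_app _ p

variable [Fintype ι] [DecidableEq ι]

lemma le_sum_of_mem_facePrime_pow {H : Finset ι} {n : ℕ} {f : MvPolynomial ι K}
    (hf : f ∈ facePrime K H ^ n) : ∀ m ∈ f.support, n ≤ ∑ i ∈ Hᶜ, m i := by
  induction n generalizing f with
  | zero => simp
  | succ n ih =>
    rw [pow_succ] at hf
    refine Submodule.mul_induction_on hf ?_ ?_
    · intro p hp q hq m hm
      obtain ⟨a, ha, b, hb, rfl⟩ := Finset.mem_add.mp (support_mul p q hm)
      obtain ⟨i, hi, hbi⟩ := mem_ideal_span_X_image.mp hq b hb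
      have h1 : b i ≤ ∑ i ∈ Hᶜ, b i :=
        Finset.single_le_sum (f := fun i => b i) (fun _ _ => Nat.zero_le _) (by simpa using hi)
      have := ih hp a ha
      simp only [Finsupp.add_apply, Finset.sum_add_distrib]
      omega
    · intro p q hp hq m hm
      rcases Finset.mem_union.mp (support_add hm) with h | h
      · exact hp m h
      · exact hq m h

end FacePrime

section SymbolicPower

variable {K : Type*} [Field K] {ι : Type*} {Δ : FaceSet ι}

lemma srIdeal_le_facePrime (hΔ : IsSimplicialComplex Δ) {H : Finset ι} (hH : H ∈ Δ) :
    srIdeal K Δ ≤ facePrime K H := by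
  rw [srIdeal, Ideal.span_le]
  rintro _ ⟨τ, hτ, rfl⟩
  have : ¬ τ ⊆ H := fun h => hτ (hΔ H hH τ h)
  obtain ⟨i, hi, hiH⟩ := Finset.not_subset.mp this
  exact Ideal.mem_of_dvd _ (Finset.dvd_prod_of_mem X hi) ((X_mem_facePrime_iff K).mpr hiH)

lemma variables_notMem_prime_mem {p : Ideal (MvPolynomial ι K)} [hp : p.IsPrime]
    (hI : srIdeal K Δ ≤ p) {σ : Finset ι} (hσ : ∀ i ∈ σ, X i ∉ p) : σ ∈ Δ := by
  by_contra h
  obtain ⟨i, hi, hip⟩ := hp.prod_mem_iff.mp (hI (Ideal.subset_span ⟨σ, h, rfl⟩))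
  exact hσ i hi hip

variable [Fintype ι]

lemma exists_facet_ge {σ : Finset ι} (hσ : σ ∈ Δ) : ∃ H ∈ facets Δ, σ ⊆ H := by
  obtain ⟨H, hle, hH⟩ := (Set.toFinite Δ).exists_le_maximal hσ
  exact ⟨H, ⟨hH.prop, fun τ hτ h => hH.eq_of_le hτ h⟩, hle⟩

lemma minimalPrimes_srIdeal (hΔ : IsSimplicialComplex Δ) :
    (srIdeal K Δ).minimalPrimes = facePrime K '' facets Δ := by
  classical
  ext p
  constructor
  · rintro ⟨⟨hp, hI⟩, hmin⟩
    have hF : (Finset.univ.filter fun i => (X i : MvPolynomial ι K) ∉ p) ∈ Δ :=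
      variables_notMem_prime_mem hI fun i hi => (Finset.mem_filter.mp hi).2
    obtain ⟨H, hH, hFH⟩ := exists_facet_ge hF
    have hle : facePrime K H ≤ p := by
      rw [facePrime, Ideal.span_le]
      rintro _ ⟨i, hi, rfl⟩
      by_contra h
      exact hi (hFH (Finset.mem_filter.mpr ⟨Finset.mem_univ i, h⟩))
    exact ⟨H, hH, hle.antisymm
      (hmin ⟨facePrime_isPrime K H, srIdeal_le_facePrime hΔ hH.1⟩ hle)⟩
  · rintro ⟨H, hH, rfl⟩
    refine ⟨⟨facePrime_isPrime K H, srIdeal_le_facePrime hΔ hH.1⟩, ?_⟩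
    rintro q ⟨hq, hI⟩ hqH
    have hF : (Finset.univ.filter fun i => (X i : MvPolynomial ι K) ∉ q) ∈ Δ :=
      variables_notMem_prime_mem hI fun i hi => (Finset.mem_filter.mp hi).2
    have hHF : H ⊆ Finset.univ.filter fun i => (X i : MvPolynomial ι K) ∉ q := fun i hi =>
      Finset.mem_filter.mpr ⟨Finset.mem_univ i,
        fun h => (X_mem_facePrime_iff K).mp (hqH h) hi⟩
    have heq := hH.2 _ hF hHF
    rw [facePrime, Ideal.span_le]
    rintro _ ⟨i, hi, rfl⟩
    by_contra h
    exact hi (heq ▸ Finset.mem_filter.mpr ⟨Finset.mem_univ i, h⟩)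

variable [DecidableEq ι]

/-- A monomial lies in the contraction of `Iⁿ` from the localization at `facePrime K H` exactly
when its degree in the variables outside the facet `H` is at least `n`. -/
lemma exists_mul_monomial_mem_pow_iff (hΔ : IsSimplicialComplex Δ) {H : Finset ι}
    (hH : H ∈ facets Δ) (n : ℕ) (a : ι →₀ ℕ) :
    (∃ s, s ∉ facePrime K H ∧ s * monomial a (1 : K) ∈ srIdeal K Δ ^ n)
      ↔ n ≤ ∑ i ∈ Hᶜ, a i := by
  constructor
  · rintro ⟨s, hs, h⟩
    rw [facePrime, mem_ideal_span_X_image] at hs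
    push Not at hs
    obtain ⟨b, hb, hbH⟩ := hs
    have hmem := Ideal.pow_right_mono (srIdeal_le_facePrime (K := K) hΔ hH.1) n h
    have hle := le_sum_of_mem_facePrime_pow K hmem (b + a) (by
      rw [mem_support_iff, coeff_mul_monomial, mul_one]
      exact mem_support_iff.mp hb)
    refine hle.trans (Finset.sum_le_sum fun i hi => ?_)
    rw [Finsupp.add_apply, hbH i (Finset.mem_compl.mp hi), zero_add]
  · intro hn
    refine ⟨(∏ i ∈ H, X i) ^ ∑ i ∈ Hᶜ, a i, fun h => ?_, ?_⟩
    · have hp := facePrime_isPrime K H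
      obtain ⟨i, hi, hip⟩ := hp.prod_mem_iff.mp (hp.mem_of_pow_mem _ h)
      exact (X_mem_facePrime_iff K).mp hip hi
    · have hfac : (∏ i ∈ H, X i) ^ (∑ i ∈ Hᶜ, a i) * monomial a (1 : K)
          = (∏ i ∈ Hᶜ, (∏ j ∈ insert i H, X j) ^ a i) * ∏ i ∈ H, X i ^ a i := by
        have h1 : monomial a (1 : K) = (∏ i ∈ H, X i ^ a i) * ∏ i ∈ Hᶜ, X i ^ a i := by
          rw [Finset.prod_mul_prod_compl, monomial_eq, map_one, one_mul,
            Finsupp.prod_fintype _ _ fun _ => pow_zero _]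
        have h2 : ∏ i ∈ Hᶜ, (∏ j ∈ insert i H, (X j : MvPolynomial ι K)) ^ a i
            = (∏ i ∈ Hᶜ, X i ^ a i) * (∏ j ∈ H, X j) ^ (∑ i ∈ Hᶜ, a i) := by
          rw [← Finset.prod_pow_eq_pow_sum, ← Finset.prod_mul_distrib]
          refine Finset.prod_congr rfl fun i hi => ?_
          rw [Finset.prod_insert (Finset.mem_compl.mp hi), mul_pow]
        rw [h1, h2]
        ring
      rw [hfac]
      refine Ideal.mul_mem_right _ _ (Ideal.pow_le_pow_right hn ?_)
      rw [← Finset.prod_pow_eq_pow_sum]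
      refine Ideal.prod_mem_prod fun i hi => Ideal.pow_mem_pow ?_ _
      refine Ideal.subset_span ⟨insert i H, fun h => ?_, rfl⟩
      have := hH.2 _ h (Finset.subset_insert i H)
      exact Finset.mem_compl.mp hi (this ▸ Finset.mem_insert_self i H)

lemma monomial_mem_symbolicPower_iff (hΔ : IsSimplicialComplex Δ) (n : ℕ) (a : ι →₀ ℕ) :
    monomial a (1 : K) ∈ symbolicPower (srIdeal K Δ) n
      ↔ ∀ H ∈ facets Δ, n ≤ ∑ i ∈ Hᶜ, a i := by
  have key : ∀ (p : Ideal (MvPolynomial ι K)) (hp : p.IsPrime),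
      monomial a (1 : K) ∈ (Ideal.map (algebraMap _ (Localization.AtPrime p))
        (srIdeal K Δ ^ n)).comap (algebraMap _ (Localization.AtPrime p))
      ↔ ∃ s, s ∉ p ∧ s * monomial a (1 : K) ∈ srIdeal K Δ ^ n := fun p hp => by
    rw [Ideal.mem_comap, IsLocalization.algebraMap_mem_map_algebraMap_iff p.primeCompl]
    rfl
  rw [symbolicPower, Submodule.mem_iInf]
  simp only [Submodule.mem_iInf]
  constructor
  · intro h H hH
    have hp : facePrime K H ∈ (srIdeal K Δ).minimalPrimes := by
      rw [minimalPrimes_srIdeal hΔ]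
      exact ⟨H, hH, rfl⟩
    exact (exists_mul_monomial_mem_pow_iff hΔ hH n a).mp ((key _ hp.1.1).mp (h _ hp))
  · intro h p hp
    obtain ⟨H, hH, rfl⟩ := minimalPrimes_srIdeal (K := K) hΔ ▸ hp
    exact (key _ hp.1.1).mpr ((exists_mul_monomial_mem_pow_iff hΔ hH n a).mpr (h H hH))

end SymbolicPower

section ScaleDegree

variable {ι : Type*}

/-- Scaling the nonnegative coordinates of a degree by `k`, and replacing the negative ones
by `-1`. -/
def scaleDegree (k : ℕ) (α : ι → ℤ) (i : ι) : ℤ :=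
  if α i < 0 then -1 else k * α i

lemma toNat_scaleDegree (k : ℕ) (α : ι → ℤ) (i : ι) :
    (scaleDegree k α i).toNat = k * (α i).toNat := by
  rw [scaleDegree]
  split_ifs with h
  · simp [Int.toNat_of_nonpos h.le]
  · obtain ⟨a, ha⟩ := Int.eq_ofNat_of_zero_le (not_lt.mp h)
    rw [ha]
    norm_cast

lemma scaleDegree_neg_iff (k : ℕ) (α : ι → ℤ) (i : ι) :
    scaleDegree k α i < 0 ↔ α i < 0 := by
  rw [scaleDegree]
  split_ifs with h
  · simp [h]
  · have : 0 ≤ (k : ℤ) * α i := mul_nonneg (Int.natCast_nonneg k) (not_lt.mp h)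
    simp [h, this]

lemma nonneg_scaleDegree_iff (k : ℕ) (α : ι → ℤ) (i : ι) :
    0 ≤ scaleDegree k α i ↔ 0 ≤ α i := by
  rw [← not_lt, scaleDegree_neg_iff, not_lt]

lemma negSupport_scaleDegree [Fintype ι] (k : ℕ) (α : ι → ℤ) :
    negSupport (scaleDegree k α) = negSupport α := by
  simp [negSupport, scaleDegree_neg_iff]

end ScaleDegree

section DegreeComplex

variable {K : Type*} [Field K] {ι : Type*} [Fintype ι] [LinearOrder ι] {Δ : FaceSet ι}

lemma mem_degreeComplex_symbolicPower_iff (hΔ : IsSimplicialComplex Δ) {n : ℕ}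
    {α : ι → ℤ} {F : Finset ι} :
    F ∈ degreeComplex K (symbolicPower (srIdeal K Δ) n) α ↔ (∀ i ∈ F, 0 ≤ α i) ∧
      ∃ H ∈ facets Δ, F ∪ negSupport α ⊆ H ∧ ∑ i ∈ Hᶜ, (α i).toNat < n := by
  have hmon : ∀ m : ℕ, monomial (Finsupp.equivFunOnFinite.symm fun i => (α i).toNat) (1 : K) *
        (∏ i ∈ F ∪ negSupport α, X i) ^ m = monomial (Finsupp.equivFunOnFinite.symm fun i =>
          (α i).toNat + if i ∈ F ∪ negSupport α then m else 0) 1 := by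
    intro m
    rw [← Finset.prod_pow, prod_X_pow, monomial_mul, one_mul]
    congr 2
    ext i
    simp [Finsupp.indicator_apply]
  simp only [degreeComplex, Set.mem_ofPred_eq, hmon, monomial_mem_symbolicPower_iff hΔ,
    Finsupp.coe_equivFunOnFinite_symm]
  refine and_congr_right fun _ => ⟨fun h => ?_, ?_⟩
  · by_contra! hne
    refine h ⟨n, fun H hH => ?_⟩
    by_cases hsub : F ∪ negSupport α ⊆ H
    · exact (hne H hH hsub).trans (Finset.sum_le_sum fun i _ => Nat.le_add_right _ _)
    · obtain ⟨i, hi, hiH⟩ := Finset.not_subset.mp hsub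
      refine le_trans ?_ (Finset.single_le_sum (fun _ _ => Nat.zero_le _)
        (Finset.mem_compl.mpr hiH))
      rw [if_pos hi]
      exact Nat.le_add_left _ _
  · rintro ⟨H, hH, hsub, hlt⟩ ⟨m, hm⟩
    refine (hm H hH).not_gt (lt_of_eq_of_lt (Finset.sum_congr rfl fun i hi => ?_) hlt)
    rw [if_neg fun h => Finset.mem_compl.mp hi (hsub h), add_zero]

/-- Nonvanishing local cohomology of a symbolic power in degree `α` bounds the positive
coordinates of `α`: otherwise the degree complex is a cone. -/
lemma lt_of_lcNonzero (hΔ : IsSimplicialComplex Δ) {n i : ℕ} (hn : 1 ≤ n) {α : ι → ℤ}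
    (h : lcNonzero K (symbolicPower (srIdeal K Δ) n) i α) (v : ι) : α v < n := by
  by_contra! hv
  refine not_hasNontrivialReducedHomology_of_cone K (v := v) (fun F hF => ?_) _ h
  rw [mem_degreeComplex_symbolicPower_iff hΔ] at hF ⊢
  obtain ⟨hF, H, hH, hsub, hlt⟩ := hF
  have hvH : v ∈ H := by
    by_contra hvH
    have := Finset.single_le_sum (f := fun i => (α i).toNat) (fun _ _ => Nat.zero_le _)
      (Finset.mem_compl.mpr hvH)
    omega
  refine ⟨fun j hj => ?_, H, hH, ?_, hlt⟩
  · rcases Finset.mem_insert.mp hj with rfl | hj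
    · omega
    · exact hF j hj
  · rw [Finset.insert_union]
    exact Finset.insert_subset hvH hsub

lemma exists_facet_card_ge_of_lcNonzero (hΔ : IsSimplicialComplex Δ) {n i : ℕ}
    {α : ι → ℤ} (h : lcNonzero K (symbolicPower (srIdeal K Δ) n) i α) :
    ∃ H ∈ facets Δ, i ≤ H.card := by
  obtain ⟨F, hF, hcard⟩ := exists_face_of_hasNontrivialReducedHomology K h
  obtain ⟨hpos, H, hH, hsub, -⟩ := (mem_degreeComplex_symbolicPower_iff hΔ).mp hF
  refine ⟨H, hH, ?_⟩
  have hdisj : Disjoint F (negSupport α) := Finset.disjoint_left.mpr fun j hj hj' =>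
    (hpos j hj).not_gt (Finset.mem_filter.mp hj').2
  have hle := Finset.card_le_card hsub
  rw [Finset.card_union_of_disjoint hdisj] at hle
  omega

lemma lcNonzero_scaleDegree (hΔ : IsSimplicialComplex Δ) {n i k : ℕ} (hk : 1 ≤ k)
    {α : ι → ℤ} (h : lcNonzero K (symbolicPower (srIdeal K Δ) (n + 1)) i α) :
    lcNonzero K (symbolicPower (srIdeal K Δ) (k * n + 1)) i (scaleDegree k α) := by
  have hcx : degreeComplex K (symbolicPower (srIdeal K Δ) (k * n + 1)) (scaleDegree k α)
      = degreeComplex K (symbolicPower (srIdeal K Δ) (n + 1)) α := by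
    ext F
    rw [mem_degreeComplex_symbolicPower_iff hΔ, mem_degreeComplex_symbolicPower_iff hΔ]
    simp only [negSupport_scaleDegree, toNat_scaleDegree, ← Finset.mul_sum, Nat.lt_succ_iff,
      mul_le_mul_iff_right₀ (Nat.lt_of_succ_le hk), nonneg_scaleDegree_iff]
  rw [lcNonzero, hcx, negSupport_scaleDegree]
  exact h

end DegreeComplex

section Regularity

variable {K : Type*} [Field K] {ι : Type*} [Fintype ι] [LinearOrder ι] {Δ : FaceSet ι}

lemma bddAbove_regQuot (hΔ : IsSimplicialComplex Δ) {n : ℕ} (hn : 1 ≤ n) :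
    BddAbove {z : ℤ | ∃ (i : ℕ) (α : ι → ℤ),
      lcNonzero K (symbolicPower (srIdeal K Δ) n) i α ∧ z = (∑ j, α j) + i} := by
  refine ⟨∑ _j : ι, (n : ℤ) + Fintype.card ι, ?_⟩
  rintro _ ⟨i, α, h, rfl⟩
  obtain ⟨H, -, hi⟩ := exists_facet_card_ge_of_lcNonzero hΔ h
  refine add_le_add (Finset.sum_le_sum fun j _ => (lt_of_lcNonzero hΔ hn h j).le) ?_
  exact_mod_cast hi.trans (Finset.card_le_univ H)

lemma lcNonzero_neg_facet (hΔ : IsSimplicialComplex Δ) {H : Finset ι}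
    (hH : H ∈ facets Δ) {n : ℕ} (hn : 1 ≤ n) :
    lcNonzero K (symbolicPower (srIdeal K Δ) n) H.card (fun i => if i ∈ H then -1 else 0) := by
  have hneg : negSupport (fun i => if i ∈ H then (-1 : ℤ) else 0) = H := by
    ext i
    by_cases hi : i ∈ H <;> simp [negSupport, hi]
  have hcx : degreeComplex K (symbolicPower (srIdeal K Δ) n)
      (fun i => if i ∈ H then (-1 : ℤ) else 0) = {∅} := by
    ext F
    rw [mem_degreeComplex_symbolicPower_iff hΔ, hneg, Set.mem_singleton_iff]
    constructor
    · rintro ⟨hF, H', hH', hsub, -⟩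
      have heq := hH.2 H' hH'.1 (Finset.union_subset_right hsub)
      refine Finset.eq_empty_of_forall_notMem fun i hi => ?_
      have := hF i hi
      rw [if_pos (heq ▸ hsub (Finset.mem_union_left _ hi))] at this
      omega
    · rintro rfl
      refine ⟨by simp, H, hH, by simp, ?_⟩
      rw [Finset.sum_eq_zero]
      · exact hn
      · intro i hi
        simp [Finset.mem_compl.mp hi]
  rw [lcNonzero, hneg, hcx, sub_self, zero_sub]
  exact hasNontrivialReducedHomology_singleton_empty K

/-- The regularity of a symbolic power is attained at a nonvanishing graded piece of local
cohomology. -/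
lemma exists_reg_eq (hΔ : IsSimplicialComplex Δ) (hne : (facets Δ).Nonempty) {n : ℕ}
    (hn : 1 ≤ n) : ∃ (i : ℕ) (α : ι → ℤ), lcNonzero K (symbolicPower (srIdeal K Δ) n) i α ∧
      reg K (symbolicPower (srIdeal K Δ) n) = (∑ j, α j) + i + 1 := by
  obtain ⟨H, hH⟩ := hne
  have hne : {z : ℤ | ∃ (i : ℕ) (α : ι → ℤ), lcNonzero K (symbolicPower (srIdeal K Δ) n) i α ∧
      z = (∑ j, α j) + i}.Nonempty := ⟨_, _, _, lcNonzero_neg_facet hΔ hH hn, rfl⟩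
  obtain ⟨i, α, h, hz⟩ := Int.csSup_mem hne (bddAbove_regQuot hΔ hn)
  exact ⟨i, α, h, by rw [reg, regQuot, hz]⟩

/-- The positive part of a degree with nonvanishing local cohomology grows linearly under scaling,
which bounds it by the asymptotic slope of the regularity. -/
lemma sum_toNat_le_of_lcNonzero (hΔ : IsSimplicialComplex Δ) {δ : ℝ}
    (hδ : Filter.Tendsto (fun n : ℕ => (reg K (symbolicPower (srIdeal K Δ) n) : ℝ) / n)
      Filter.atTop (nhds δ)) {n i : ℕ} {α : ι → ℤ}
    (h : lcNonzero K (symbolicPower (srIdeal K Δ) (n + 1)) i α) :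
    ((∑ j, (α j).toNat : ℕ) : ℝ) ≤ δ * n := by
  rcases Nat.eq_zero_or_pos n with rfl | hn
  · have : ∑ j, (α j).toNat = 0 := Finset.sum_eq_zero fun j _ => by
      have := lt_of_lcNonzero hΔ le_rfl h j
      omega
    simp [this]
  set A := ∑ j, (α j).toNat with hA
  have hlow : ∀ k : ℕ, 1 ≤ k → (k * A : ℝ) - Fintype.card ι
      ≤ reg K (symbolicPower (srIdeal K Δ) (k * n + 1)) := by
    intro k hk
    have hmem := le_csSup (bddAbove_regQuot (K := K) hΔ (Nat.le_add_left 1 (k * n)))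
      ⟨i, _, lcNonzero_scaleDegree hΔ hk h, rfl⟩
    have hsum : (k * A : ℤ) - Fintype.card ι ≤ ∑ j, scaleDegree k α j := by
      have : (k * A : ℤ) - Fintype.card ι = ∑ j, ((k * (α j).toNat : ℕ) - 1 : ℤ) := by
        simp [hA, Finset.mul_sum]
      rw [this]
      refine Finset.sum_le_sum fun j _ => ?_
      rw [← toNat_scaleDegree]
      have : -1 ≤ scaleDegree k α j := by
        by_cases hj : α j < 0
        · simp [scaleDegree, hj]
        · have := mt (scaleDegree_neg_iff k α j).mp hj
          omega
      omega
    have : (k * A : ℤ) - Fintype.card ι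
        ≤ reg K (symbolicPower (srIdeal K Δ) (k * n + 1)) := by
      rw [reg, regQuot]
      omega
    exact_mod_cast this
  have hsub : Filter.Tendsto (fun k : ℕ => k * n + 1) Filter.atTop Filter.atTop :=
    Filter.tendsto_atTop_mono (fun k => (Nat.le_mul_of_pos_right k hn).trans (Nat.le_succ _))
      Filter.tendsto_id
  have hinv : Filter.Tendsto (fun k : ℕ => ((k : ℝ))⁻¹) Filter.atTop (nhds 0) :=
    tendsto_inv_atTop_nhds_zero_nat
  have hR : Filter.Tendsto (fun k : ℕ =>
      (reg K (symbolicPower (srIdeal K Δ) (k * n + 1)) : ℝ) / ((k * n + 1 : ℕ) : ℝ)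
        * (n + (k : ℝ)⁻¹)) Filter.atTop (nhds (δ * (n + 0))) :=
    (hδ.comp hsub).mul (tendsto_const_nhds.add hinv)
  have hL : Filter.Tendsto (fun k : ℕ => (A : ℝ) - Fintype.card ι * (k : ℝ)⁻¹) Filter.atTop
      (nhds (A - Fintype.card ι * 0)) := tendsto_const_nhds.sub (hinv.const_mul _)
  rw [add_zero] at hR
  rw [mul_zero, sub_zero] at hL
  refine le_of_tendsto_of_tendsto hL hR ?_
  filter_upwards [Filter.eventually_ge_atTop 1] with k hk
  have hk0 : (0 : ℝ) < k := by exact_mod_cast hk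
  have h1 : (reg K (symbolicPower (srIdeal K Δ) (k * n + 1)) : ℝ) / ((k * n + 1 : ℕ) : ℝ)
      * (n + (k : ℝ)⁻¹) = reg K (symbolicPower (srIdeal K Δ) (k * n + 1)) / k := by
    push_cast
    field_simp
  rw [h1, le_div_iff₀ hk0]
  refine le_trans (le_of_eq ?_) (hlow k hk)
  field_simp

end Regularity

/-- For a square-free monomial ideal `I` of `R = K[x_1, …, x_r]` and
all `n ≥ 1`: `reg(I^{(n)}) ≤ δ(I)·(n − 1) + dim(R/I) + 1`. -/
theorem statement2 {K : Type*} [Field K] {r : ℕ}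
    (I : Ideal (MvPolynomial (Fin r) K))
    (hI : ∃ Δ : FaceSet (Fin r), IsSimplicialComplex Δ ∧ I = srIdeal K Δ)
    (δ : ℝ)
    (hδ : Filter.Tendsto (fun n : ℕ => (reg K (symbolicPower I n) : ℝ) / n)
      Filter.atTop (nhds δ))
    (d : ℕ) (hdim : ringKrullDim (MvPolynomial (Fin r) K ⧸ I) = (d : WithBot ℕ∞))
    (n : ℕ) (hn : 1 ≤ n) :
    (reg K (symbolicPower I n) : ℝ) ≤ δ * (n - 1) + d + 1 := by
  obtain ⟨Δ, hΔ, rfl⟩ := hI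
  have hempty : ∅ ∈ Δ := by
    by_contra h
    have htop : srIdeal K Δ = ⊤ :=
      (Ideal.eq_top_iff_one _).mpr (Ideal.subset_span ⟨∅, h, by simp⟩)
    have : Subsingleton (MvPolynomial (Fin r) K ⧸ srIdeal K Δ) :=
      Ideal.Quotient.subsingleton_iff.mpr htop
    rw [ringKrullDim_eq_bot_of_subsingleton] at hdim
    exact absurd hdim (by simp)
  obtain ⟨H₀, hH₀, -⟩ := exists_facet_ge hempty
  obtain ⟨m, rfl⟩ : ∃ m, n = m + 1 := ⟨n - 1, by omega⟩
  obtain ⟨i, α, h, hreg⟩ := exists_reg_eq (K := K) hΔ ⟨H₀, hH₀⟩ hn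
  obtain ⟨H, hH, hi⟩ := exists_facet_card_ge_of_lcNonzero hΔ h
  have hd : H.card ≤ d := by
    have := card_le_ringKrullDim_quotient K (srIdeal_le_facePrime hΔ hH.1)
    rw [hdim] at this
    exact_mod_cast this
  have hA := sum_toNat_le_of_lcNonzero hΔ hδ h
  have hsum : ∑ j, α j ≤ ((∑ j, (α j).toNat : ℕ) : ℤ) := by
    rw [Nat.cast_sum]
    exact Finset.sum_le_sum fun j _ => Int.self_le_toNat (α j)
  have hle : (reg K (symbolicPower (srIdeal K Δ) (m + 1)) : ℝ)
      ≤ (∑ j, (α j).toNat : ℕ) + d + 1 := by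
    have : reg K (symbolicPower (srIdeal K Δ) (m + 1))
        ≤ ((∑ j, (α j).toNat : ℕ) : ℤ) + d + 1 := by
      rw [hreg]
      omega
    exact_mod_cast this
  push_cast at hA hle ⊢
  linarith
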